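/- arXiv:2104.13788 — 6 statements merged into one kernel-verified Lean document; each statement's English description precedes it below -/
import Mathlib

section
/- Let P be a set, F = F(P) the free abelian monoid over P, and H ⊆ F a submonoid such that the inclusion H ↪ F is a divisor theory whose class group G = q(F)/q(H) is a torsion group. Then there exists a subset G_0* ⊆ G such that the inclusion B(G_0*) ↪ F(G_0*) is a divisor theory and there exists a transfer homomorphism θ*: H → B(G_0*). -/
open scoped Classical

/-- The monoid of zero-sum multisets over `G0 ⊆ G` (monoid of zero-sum sequences `B(G0)`),
realized as an additive submonoid of the free abelian monoid `F(G0)` of multisets. -/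
def ZeroSum {G : Type*} [AddCommGroup G] (G0 : Set G) : AddSubmonoid (Multiset G) where
  carrier := {S | (∀ x ∈ S, x ∈ G0) ∧ S.sum = 0}
  zero_mem' := ⟨fun x hx => absurd hx (Multiset.notMem_zero x), Multiset.sum_zero⟩
  add_mem' := by
    rintro a b ⟨ha1, ha2⟩ ⟨hb1, hb2⟩
    refine ⟨fun x hx => ?_, ?_⟩
    · rcases Multiset.mem_add.mp hx with h | h
      exacts [ha1 x h, hb1 x h]
    · rw [Multiset.sum_add, ha2, hb2, add_zero]

/-- The inclusion `B(G0) ↪ F(G0)` is a divisor theory: every `g ∈ G0` is the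
greatest common divisor (pointwise minimum of multiplicities) of a finite nonempty
set of zero-sum sequences. -/
def IsDivisorTheoryB {G : Type*} [AddCommGroup G] (G0 : Set G) : Prop :=
  ∀ g ∈ G0, ∃ (X : Finset (Multiset G)) (hX : X.Nonempty),
    (X : Set (Multiset G)) ⊆ (ZeroSum G0 : Set (Multiset G)) ∧
      ∀ h : G, X.inf' hX (fun B => Multiset.count h B) = Multiset.count h ({g} : Multiset G)

/-- A transfer homomorphism between reduced commutative (additive) monoids:
surjective, trivial kernel as a preimage of `0`, and factorizations lift. -/
def IsTransferHomAdd {M N : Type*} [AddCommMonoid M] [AddCommMonoid N] (θ : M →+ N) : Prop :=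
  Function.Surjective θ ∧ (∀ a : M, θ a = 0 → a = 0) ∧
    ∀ (u : M) (b c : N), θ u = b + c → ∃ v w : M, u = v + w ∧ θ v = b ∧ θ w = c

/-- The canonical embedding of the free abelian monoid `F(P)` into its quotient group
`q(F)`, i.e. of `P →₀ ℕ` into `P →₀ ℤ`. -/
noncomputable def toIntF {P : Type*} : (P →₀ ℕ) →+ (P →₀ ℤ) :=
  Finsupp.mapRange.addMonoidHom (Nat.castAddMonoidHom ℤ)

/-- The inclusion `H ↪ F(P)` is a divisor homomorphism. -/
def IsDivHomF {P : Type*} (H : AddSubmonoid (P →₀ ℕ)) : Prop :=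
  ∀ a ∈ H, ∀ b ∈ H, a ≤ b → b - a ∈ H

/-- The inclusion `H ↪ F(P)` is cofinal. -/
def IsCofinalF {P : Type*} (H : AddSubmonoid (P →₀ ℕ)) : Prop :=
  ∀ x : P →₀ ℕ, ∃ h ∈ H, x ≤ h

/-- The inclusion `H ↪ F(P)` is a divisor theory: a divisor homomorphism such that every
`p ∈ P` is the pointwise infimum of a finite nonempty subset of `H`. -/
def IsDivTheoryF {P : Type*} (H : AddSubmonoid (P →₀ ℕ)) : Prop :=
  IsDivHomF H ∧ ∀ p : P, ∃ (X : Finset (P →₀ ℕ)) (hX : X.Nonempty),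
    (X : Set (P →₀ ℕ)) ⊆ (H : Set (P →₀ ℕ)) ∧
      ∀ q : P, X.inf' hX (fun h => h q) = Finsupp.single p 1 q

/-- The quotient group `q(H)` of `H`, as a subgroup of `q(F) = (P →₀ ℤ)`. -/
noncomputable def qHsub {P : Type*} (H : AddSubmonoid (P →₀ ℕ)) : AddSubgroup (P →₀ ℤ) :=
  AddSubgroup.closure (⇑toIntF '' (H : Set (P →₀ ℕ)))

/-- The class group `G = q(F)/q(H)` of the inclusion `H ↪ F(P)`. -/
abbrev ClassGrp {P : Type*} (H : AddSubmonoid (P →₀ ℕ)) : Type _ :=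
  (P →₀ ℤ) ⧸ qHsub H

/-- The canonical projection `q(F) → G`, `x ↦ [x]`. -/
noncomputable def clsOf {P : Type*} (H : AddSubmonoid (P →₀ ℕ)) : (P →₀ ℤ) →+ ClassGrp H :=
  QuotientAddGroup.mk' (qHsub H)

/-- The set `G_P = {[p] : p ∈ P}` of classes containing prime divisors. -/
def GPset {P : Type*} (H : AddSubmonoid (P →₀ ℕ)) : Set (ClassGrp H) :=
  {g | ∃ p : P, g = clsOf H (Finsupp.single p 1)}

/-- An abelian torsion group: every element has finite order. -/
def IsTorsionAdd (G : Type*) [AddCommGroup G] : Prop :=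
  ∀ g : G, ∃ n : ℕ, 0 < n ∧ n • g = 0

namespace TorsionTransfer

/-- The class of `x ∈ F(P)` in the class group. -/
noncomputable def natCls {P : Type*} (H : AddSubmonoid (P →₀ ℕ)) : (P →₀ ℕ) →+ ClassGrp H :=
  (clsOf H).comp toIntF

lemma toIntF_injective {P : Type*} : Function.Injective (toIntF : (P →₀ ℕ) →+ (P →₀ ℤ)) :=
  Finsupp.mapRange_injective _ (by simp) Nat.cast_injective

lemma natCls_eq_zero_iff {P : Type*} {H : AddSubmonoid (P →₀ ℕ)} (hH : IsDivHomF H)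
    (x : P →₀ ℕ) : natCls H x = 0 ↔ x ∈ H := by
  have key : natCls H x = 0 ↔ toIntF x ∈ qHsub H := by
    simp [natCls, clsOf]
  rw [key]
  constructor
  · intro hx
    have hdiff : ∀ y ∈ qHsub H, ∃ a ∈ H, ∃ b ∈ H, y = toIntF a - toIntF b := by
      intro y hy
      refine AddSubgroup.closure_induction ?_ ?_ ?_ ?_ hy
      · rintro _ ⟨a, ha, rfl⟩
        exact ⟨a, ha, 0, H.zero_mem, by simp⟩
      · exact ⟨0, H.zero_mem, 0, H.zero_mem, by simp⟩
      · rintro _ _ _ _ ⟨a, ha, b, hb, rfl⟩ ⟨a', ha', b', hb', rfl⟩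
        refine ⟨a + a', H.add_mem ha ha', b + b', H.add_mem hb hb', ?_⟩
        simp only [map_add]; abel
      · rintro _ _ ⟨a, ha, b, hb, rfl⟩
        exact ⟨b, hb, a, ha, by abel⟩
    obtain ⟨a, ha, b, hb, hab⟩ := hdiff _ hx
    have hsum : x + b = a := by
      apply toIntF_injective
      rw [map_add, hab]; abel
    have hx' : x = a - b := by rw [← hsum, add_tsub_cancel_right]
    rw [hx']
    exact hH b hb a ha (by rw [← hsum]; exact le_add_self)
  · intro hx
    exact AddSubgroup.subset_closure ⟨x, hx, rfl⟩

lemma exists_add_of_map_eq_add {α β : Type*} (f : α → β) (B C : Multiset β) (M : Multiset α)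
    (h : M.map f = B + C) :
    ∃ M₁ M₂, M = M₁ + M₂ ∧ M₁.map f = B ∧ M₂.map f = C := by
  induction B using Multiset.induction_on generalizing M with
  | empty => exact ⟨0, M, by simp, by simp, by simpa using h⟩
  | cons b B ih =>
    rw [Multiset.cons_add] at h
    obtain ⟨a, ha, hab, hM⟩ := (Multiset.map_eq_cons f M (B + C) b).2 h
    obtain ⟨M₁, M₂, h₁, h₂, h₃⟩ := ih _ hM
    refine ⟨a ::ₘ M₁, M₂, ?_, by simp [hab, h₂], h₃⟩
    rw [Multiset.cons_add, ← h₁, Multiset.cons_erase ha]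

lemma exists_join_eq_of_card {α : Type*} (e k : ℕ) (M : Multiset α) (h : M.card = k * e) :
    ∃ N : Multiset (Multiset α), N.join = M ∧ ∀ x ∈ N, x.card = e := by
  induction k generalizing M with
  | zero => exact ⟨0, by simpa [eq_comm] using h, by simp⟩
  | succ k ih =>
    obtain ⟨A, R, rfl, hcard⟩ : ∃ A R : Multiset α, M = A + R ∧ A.card = e := by
      induction M using Quotient.inductionOn with
      | h l =>
        refine ⟨l.take e, l.drop e, by simp, ?_⟩
        have hl : l.length = (k + 1) * e := h
        rw [Multiset.coe_card, List.length_take, hl]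
        exact min_eq_left (Nat.le_mul_of_pos_left e k.succ_pos)
    obtain ⟨N, hN, hN'⟩ := ih R (by rw [Multiset.card_add, hcard] at h; linarith)
    refine ⟨A ::ₘ N, by simp [hN], ?_⟩
    intro x hx
    rcases Multiset.mem_cons.1 hx with rfl | hx
    exacts [hcard, hN' x hx]

section Weights

variable {P G : Type*}

/-- The multiset `S` as a rational-valued multiplicity function. -/
noncomputable def multRat : Multiset G →+ (G →₀ ℚ) :=
  (Finsupp.mapRange.addMonoidHom (Nat.castAddMonoidHom ℚ)).comp
    (Multiset.toFinsupp : Multiset G ≃+ (G →₀ ℕ)).toAddMonoidHom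

lemma multRat_injective : Function.Injective (multRat : Multiset G →+ (G →₀ ℚ)) :=
  (Finsupp.mapRange_injective _ (by simp) Nat.cast_injective).comp
    (Multiset.toFinsupp : Multiset G ≃+ (G →₀ ℕ)).injective

lemma multRat_singleton (t : G) : multRat {t} = Finsupp.single t 1 := by
  simp [multRat]

variable [AddCommGroup G]

/-- The target `m(p)[p]` of the prime `p` for the weight function `m`. -/
noncomputable def target (c : (P →₀ ℕ) →+ G) (m : P → ℕ) (p : P) : G :=
  m p • c (Finsupp.single p 1)

/-- The homomorphism sending `p` to `1 / m(p)` times the target of `p`. -/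
noncomputable def weight (c : (P →₀ ℕ) →+ G) (m : P → ℕ) : (P →₀ ℕ) →+ (G →₀ ℚ) :=
  Finsupp.liftAddHom fun p =>
    (Finsupp.singleAddHom (target c m p)).comp
      ((AddMonoidHom.mulRight ((m p : ℚ)⁻¹)).comp (Nat.castAddMonoidHom ℚ))

lemma weight_single (c : (P →₀ ℕ) →+ G) (m : P → ℕ) (p : P) (n : ℕ) :
    weight c m (Finsupp.single p n) = Finsupp.single (target c m p) (n * (m p : ℚ)⁻¹) := by
  simp [weight]

lemma weight_apply (c : (P →₀ ℕ) →+ G) (m : P → ℕ) (x : P →₀ ℕ) :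
    weight c m x =
      ∑ p ∈ x.support, Finsupp.single (target c m p) ((x p : ℚ) * (m p : ℚ)⁻¹) := by
  simp [weight, Finsupp.liftAddHom_apply, Finsupp.sum]

lemma weight_congr (c : (P →₀ ℕ) →+ G) {m m' : P → ℕ} {x : P →₀ ℕ}
    (h : ∀ p ∈ x.support, m p = m' p) : weight c m x = weight c m' x := by
  rw [weight_apply, weight_apply]
  refine Finset.sum_congr rfl fun p hp => ?_
  rw [target, target, h p hp]

lemma mem_range_target_of_weight {c : (P →₀ ℕ) →+ G} {m : P → ℕ} {x : P →₀ ℕ} {t : G}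
    (h : weight c m x = Finsupp.single t 1) : t ∈ Set.range (target c m) := by
  by_contra ht
  have h0 : weight c m x t = 0 := by
    rw [weight_apply, Finsupp.finsetSum_apply]
    refine Finset.sum_eq_zero fun p _ => ?_
    exact Finsupp.single_eq_of_ne fun hp => ht ⟨p, hp.symm⟩
  rw [h] at h0
  simp at h0

/-- A multiset of elements of `F(P)` all of whose members have weight one, concentrated
at their own class. -/
def IsBlocks (c : (P →₀ ℕ) →+ G) (m : P → ℕ) (M : Multiset (P →₀ ℕ)) : Prop :=
  ∀ b ∈ M, weight c m b = Finsupp.single (c b) 1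

lemma IsBlocks.weight_sum {c : (P →₀ ℕ) →+ G} {m : P → ℕ} {M : Multiset (P →₀ ℕ)}
    (hM : IsBlocks c m M) : weight c m M.sum = multRat (M.map c) := by
  induction M using Multiset.induction_on with
  | empty => simp
  | cons b M ih =>
    rw [Multiset.sum_cons, map_add, Multiset.map_cons, ← Multiset.singleton_add, map_add,
      ih fun x hx => hM x (Multiset.mem_cons_of_mem hx), hM b (Multiset.mem_cons_self b M),
      multRat_singleton]

/-- A weight function is admissible if `m(p)` divides the order of `[p]` and every element of
class zero decomposes into blocks. -/
def Admissible (c : (P →₀ ℕ) →+ G) (m : P → ℕ) : Prop :=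
  (∀ p, m p ∣ addOrderOf (c (Finsupp.single p 1))) ∧
    ∀ x, c x = 0 → ∃ M : Multiset (P →₀ ℕ), M.sum = x ∧ IsBlocks c m M

lemma admissible_one (c : (P →₀ ℕ) →+ G) : Admissible c 1 := by
  refine ⟨fun p => one_dvd _, fun x hx => ?_⟩
  refine ⟨(Finsupp.toMultiset x).map fun p => Finsupp.single p 1, ?_, ?_⟩
  · clear hx
    induction x using Finsupp.induction_linear with
    | zero => simp
    | add f g hf hg => simp [hf, hg]
    | single p n => simp [Finsupp.toMultiset_single, Multiset.map_nsmul, Multiset.sum_nsmul]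
  · intro b hb
    obtain ⟨p, -, rfl⟩ := Multiset.mem_map.1 hb
    simp [weight_single, target]

lemma exists_mem_chain_eq_on_finset {c : Set (P → ℕ)} (hc : IsChain (· ≤ ·) c)
    (hne : c.Nonempty) {u : P → ℕ} (hle : ∀ m ∈ c, m ≤ u) (hu : ∀ p, ∃ m ∈ c, m p = u p)
    (s : Finset P) : ∃ m ∈ c, ∀ p ∈ s, m p = u p := by
  induction s using Finset.induction_on with
  | empty =>
    obtain ⟨m, hm⟩ := hne
    exact ⟨m, hm, by simp⟩
  | insert a s _ ih =>
    obtain ⟨m, hm, hms⟩ := ih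
    obtain ⟨m', hm', ha⟩ := hu a
    rcases hc.total hm hm' with h | h
    · refine ⟨m', hm', fun p hp => ?_⟩
      rcases Finset.mem_insert.1 hp with rfl | hp
      · exact ha
      · exact le_antisymm (hle m' hm' p) (by rw [← hms p hp]; exact h p)
    · refine ⟨m, hm, fun p hp => ?_⟩
      rcases Finset.mem_insert.1 hp with rfl | hp
      · exact le_antisymm (hle m hm p) (by rw [← ha]; exact h p)
      · exact hms p hp

lemma exists_maximal_admissible (c : (P →₀ ℕ) →+ G) (hG : ∀ g : G, 0 < addOrderOf g) :
    ∃ m, Maximal (Admissible c) m := by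
  have hz := zorn_le_nonempty₀ {m | Admissible c m} ?_ 1 (admissible_one c)
  · obtain ⟨m, -, hm⟩ := hz
    exact ⟨m, hm⟩
  intro s hs hchain y hy
  have hbdd : ∀ p, BddAbove ((fun m : P → ℕ => m p) '' s) := by
    refine fun p => ⟨addOrderOf (c (Finsupp.single p 1)), ?_⟩
    rintro _ ⟨m, hm, rfl⟩
    exact Nat.le_of_dvd (hG _) ((hs hm).1 p)
  set u : P → ℕ := fun p => sSup ((fun m : P → ℕ => m p) '' s)
  have hle : ∀ m ∈ s, m ≤ u := fun m hm p => le_csSup (hbdd p) ⟨m, hm, rfl⟩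
  have hu : ∀ p, ∃ m ∈ s, m p = u p := fun p =>
    Nat.sSup_mem (Set.Nonempty.image (fun m : P → ℕ => m p) ⟨y, hy⟩) (hbdd p)
  refine ⟨u, ⟨fun p => ?_, fun x hx => ?_⟩, hle⟩
  · obtain ⟨m, hm, hmp⟩ := hu p
    rw [← hmp]
    exact (hs hm).1 p
  · obtain ⟨m, hm, hmu⟩ := exists_mem_chain_eq_on_finset hchain ⟨y, hy⟩ hle hu x.support
    obtain ⟨M, rfl, hM⟩ := (hs hm).2 x hx
    refine ⟨M, rfl, fun b hb => ?_⟩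
    rw [← hM b hb]
    refine (weight_congr c fun p hp => hmu p ?_).symm
    exact Finsupp.support_mono (Multiset.single_le_sum (by simp) b hb) hp

/-- Replace `g` by `e • g`, dividing its multiplicity by `e`. -/
noncomputable def contract (g : G) (e : ℕ) : (G →₀ ℚ) →+ (G →₀ ℚ) :=
  Finsupp.liftAddHom fun t =>
    if t = g then (Finsupp.singleAddHom (e • g)).comp (AddMonoidHom.mulRight ((e : ℚ)⁻¹))
    else Finsupp.singleAddHom t

lemma contract_single_self (g : G) (e : ℕ) (q : ℚ) :
    contract g e (Finsupp.single g q) = Finsupp.single (e • g) (q * (e : ℚ)⁻¹) := by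
  simp [contract]

lemma contract_single_of_ne {g t : G} (e : ℕ) (h : t ≠ g) (q : ℚ) :
    contract g e (Finsupp.single t q) = Finsupp.single t q := by
  simp [contract, h]

/-- Multiply by `e` the weights of all primes with target `g`. -/
noncomputable def scaleAt (c : (P →₀ ℕ) →+ G) (m : P → ℕ) (g : G) (e : ℕ) (p : P) : ℕ :=
  if target c m p = g then m p * e else m p

lemma weight_scaleAt (c : (P →₀ ℕ) →+ G) (m : P → ℕ) (g : G) (e : ℕ) (x : P →₀ ℕ) :
    weight c (scaleAt c m g e) x = contract g e (weight c m x) := by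
  induction x using Finsupp.induction_linear with
  | zero => simp
  | add f g hf hg => simp [hf, hg]
  | single p n =>
    rw [weight_single, weight_single]
    by_cases hp : target c m p = g
    · have ht : target c (scaleAt c m g e) p = e • g := by
        rw [target, scaleAt, if_pos hp, mul_comm, mul_smul, ← hp, target]
      rw [ht, hp, contract_single_self, scaleAt, if_pos hp]
      push_cast
      rw [mul_inv, mul_assoc]
    · have hs : scaleAt c m g e p = m p := if_neg hp
      rw [contract_single_of_ne e hp, target, hs, target]

lemma isBlocks_scaleAt_of_card {c : (P →₀ ℕ) →+ G} {m : P → ℕ} {g : G} {e : ℕ} (he : 0 < e)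
    {M : Multiset (P →₀ ℕ)} (hM : IsBlocks c m M) (hg : ∀ b ∈ M, c b = g) (hcard : M.card = e) :
    weight c (scaleAt c m g e) M.sum = Finsupp.single (c M.sum) 1 := by
  have hrep : M.map c = Multiset.replicate e g := by
    rw [Multiset.eq_replicate]
    refine ⟨by simpa using hcard, fun t ht => ?_⟩
    obtain ⟨b, hb, rfl⟩ := Multiset.mem_map.1 ht
    exact hg b hb
  have he' : (e : ℚ) ≠ 0 := by exact_mod_cast he.ne'
  rw [weight_scaleAt, hM.weight_sum, map_multiset_sum, hrep, ← Multiset.nsmul_singleton,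
    map_nsmul, multRat_singleton, map_nsmul, contract_single_self, Multiset.nsmul_singleton,
    Multiset.sum_replicate, Finsupp.smul_single]
  simp [he']

lemma admissible_scaleAt {c : (P →₀ ℕ) →+ G} {m : P → ℕ} (hm : Admissible c m) {g : G} {e : ℕ}
    (he : 0 < e) (hord : e ∣ addOrderOf g)
    (hdvd : ∀ S : Multiset G, (∀ t ∈ S, t ∈ Set.range (target c m)) → S.sum = 0 →
      e ∣ S.count g) :
    Admissible c (scaleAt c m g e) := by
  refine ⟨fun p => ?_, fun x hx => ?_⟩
  · by_cases hp : target c m p = g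
    · rw [scaleAt, if_pos hp]
      obtain ⟨k, hk⟩ := hm.1 p
      rcases Nat.eq_zero_or_pos (addOrderOf (c (Finsupp.single p 1))) with h0 | hpos
      · rw [h0]; exact dvd_zero _
      · have hmp : m p ≠ 0 := by rintro h; rw [h, zero_mul] at hk; omega
        rw [hk]
        refine mul_dvd_mul_left _ (hord.trans (addOrderOf_dvd_of_nsmul_eq_zero ?_))
        rw [← hp, target, ← mul_smul, mul_comm, ← hk, addOrderOf_nsmul_eq_zero]
    · rw [scaleAt, if_neg hp]
      exact hm.1 p
  · obtain ⟨M, rfl, hM⟩ := hm.2 x hx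
    have hcount : e ∣ (M.map c).count g := by
      refine hdvd _ (fun t ht => ?_) (by rw [← map_multiset_sum, hx])
      obtain ⟨b, hb, rfl⟩ := Multiset.mem_map.1 ht
      exact mem_range_target_of_weight (hM b hb)
    have hcard : e ∣ (M.filter fun b => c b = g).card := by
      rw [Multiset.count_map] at hcount
      simpa only [eq_comm] using hcount
    obtain ⟨k, hk⟩ := hcard
    obtain ⟨N, hN, hNcard⟩ := exists_join_eq_of_card e k _ (hk.trans (mul_comm e k))
    refine ⟨N.map Multiset.sum + M.filter fun b => ¬ c b = g, ?_, fun b hb => ?_⟩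
    · rw [Multiset.sum_add, ← Multiset.sum_join, hN, ← Multiset.sum_add,
        Multiset.filter_add_not]
    · rcases Multiset.mem_add.1 hb with hb | hb
      · obtain ⟨B, hB, rfl⟩ := Multiset.mem_map.1 hb
        have hsub : ∀ b ∈ B, b ∈ M ∧ c b = g := fun b hb =>
          Multiset.mem_filter.1 (hN ▸ Multiset.mem_join.2 ⟨B, hB, hb⟩)
        exact isBlocks_scaleAt_of_card he (fun b hb => hM b (hsub b hb).1)
          (fun b hb => (hsub b hb).2) (hNcard B hB)
      · obtain ⟨hb, hbg⟩ := Multiset.mem_filter.1 hb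
        rw [weight_scaleAt, hM b hb, contract_single_of_ne e hbg]

lemma addOrderOf_mk_dvd_count (G₀ : Set G) (g : G) (S : Multiset G) (hS : ∀ t ∈ S, t ∈ G₀)
    (hsum : S.sum = 0) :
    addOrderOf (QuotientAddGroup.mk' (AddSubgroup.closure (G₀ \ {g})) g) ∣ S.count g := by
  apply addOrderOf_dvd_of_nsmul_eq_zero
  rw [← map_nsmul, QuotientAddGroup.mk'_apply, QuotientAddGroup.eq_zero_iff]
  have hsplit := congrArg Multiset.sum (Multiset.filter_add_not (fun t => t = g) S)
  have hfilter : S.filter (fun t => t = g) = Multiset.replicate (S.count g) g := by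
    convert Multiset.filter_eq' S g
  rw [Multiset.sum_add, hsum, hfilter, Multiset.sum_replicate] at hsplit
  rw [eq_neg_of_add_eq_zero_left hsplit]
  refine neg_mem (multiset_sum_mem _ fun t ht => ?_)
  obtain ⟨ht, htg⟩ := Multiset.mem_filter.1 ht
  exact AddSubgroup.subset_closure ⟨hS t ht, htg⟩

lemma isDivisorTheoryB_of_mem_closure (hG : ∀ g : G, 0 < addOrderOf g) {G₀ : Set G}
    (h : ∀ g ∈ G₀, g ∈ AddSubgroup.closure (G₀ \ {g})) : IsDivisorTheoryB G₀ := by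
  intro g hg
  have hmul : ∀ y ∈ AddSubgroup.closure (G₀ \ {g}),
      ∃ S : Multiset G, (∀ t ∈ S, t ∈ G₀ \ {g}) ∧ S.sum = y := by
    intro y hy
    refine AddSubgroup.closure_induction ?_ ?_ ?_ ?_ hy
    · intro t ht
      exact ⟨{t}, by simpa using ht, by simp⟩
    · exact ⟨0, by simp, by simp⟩
    · rintro _ _ _ _ ⟨S, hS, rfl⟩ ⟨T, hT, rfl⟩
      refine ⟨S + T, fun t ht => ?_, by simp⟩
      rcases Multiset.mem_add.1 ht with ht | ht
      exacts [hS t ht, hT t ht]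
    · rintro _ _ ⟨S, hS, rfl⟩
      refine ⟨(addOrderOf S.sum - 1) • S, fun t ht => hS t (Multiset.mem_of_mem_nsmul ht), ?_⟩
      rw [Multiset.sum_nsmul, eq_neg_iff_add_eq_zero, ← succ_nsmul,
        Nat.sub_add_cancel (hG _), addOrderOf_nsmul_eq_zero]
  obtain ⟨S, hS, hsum⟩ := hmul (-g) (neg_mem (h g hg))
  have hgS : S.count g = 0 := Multiset.count_eq_zero.2 fun hmem => (hS g hmem).2 rfl
  refine ⟨{g ::ₘ S, Multiset.replicate (addOrderOf g) g}, by simp, ?_, fun t => ?_⟩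
  · intro B hB
    simp only [Finset.coe_insert, Finset.coe_singleton, Set.mem_insert_iff,
      Set.mem_singleton_iff] at hB
    rcases hB with rfl | rfl
    · refine ⟨fun t ht => ?_, by simp [hsum]⟩
      rcases Multiset.mem_cons.1 ht with rfl | ht
      exacts [hg, (hS t ht).1]
    · refine ⟨fun t ht => ?_, by simp [addOrderOf_nsmul_eq_zero]⟩
      rwa [Multiset.eq_of_mem_replicate ht]
  · rw [Finset.inf'_insert (by simp), Finset.inf'_singleton]
    by_cases ht : t = g
    · subst ht
      rw [Multiset.count_cons_self, hgS, Multiset.count_replicate_self,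
        Multiset.count_singleton_self]
      exact min_eq_left (hG t)
    · rw [Multiset.count_replicate, if_neg (Ne.symm ht), Multiset.count_singleton, if_neg ht]
      exact Nat.min_zero _

lemma isDivisorTheoryB_of_maximal {c : (P →₀ ℕ) →+ G} (hG : ∀ g : G, 0 < addOrderOf g)
    {m : P → ℕ} (hm : Maximal (Admissible c) m) :
    IsDivisorTheoryB (Set.range (target c m)) := by
  refine isDivisorTheoryB_of_mem_closure hG ?_
  rintro g ⟨p, hp⟩
  set K := AddSubgroup.closure (Set.range (target c m) \ {g})
  set e := addOrderOf (QuotientAddGroup.mk' K g) with he_def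
  have hord : e ∣ addOrderOf g := addOrderOf_map_dvd _ g
  have he : 0 < e := Nat.pos_of_dvd_of_pos hord (hG g)
  have hadm := admissible_scaleAt hm.prop he hord
    fun S hS hsum => addOrderOf_mk_dvd_count _ g S hS hsum
  have hle : m ≤ scaleAt c m g e := fun q => by
    unfold scaleAt
    split_ifs
    exacts [Nat.le_mul_of_pos_right _ he, le_rfl]
  have hge := hm.le_of_ge hadm hle p
  rw [scaleAt, if_pos hp] at hge
  have hmp : 0 < m p := Nat.pos_of_dvd_of_pos (hm.prop.1 p) (hG _)
  have he1 : e = 1 :=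
    le_antisymm (Nat.le_of_mul_le_mul_left (by rwa [mul_one]) hmp) he
  rw [he_def, AddMonoid.addOrderOf_eq_one_iff, QuotientAddGroup.mk'_apply,
    QuotientAddGroup.eq_zero_iff] at he1
  exact he1

lemma exists_transferHom {c : (P →₀ ℕ) →+ G} (hG : ∀ g : G, 0 < addOrderOf g) {m : P → ℕ}
    (hm : Admissible c m) (H : AddSubmonoid (P →₀ ℕ)) (hH : ∀ x, c x = 0 ↔ x ∈ H) :
    ∃ θ : H →+ ZeroSum (Set.range (target c m)), IsTransferHomAdd θ := by
  choose M hsum hblocks using fun x : H => hm.2 x ((hH x).2 x.2)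
  have hmult : ∀ x : H, multRat ((M x).map c) = weight c m x := fun x => by
    rw [← (hblocks x).weight_sum, hsum]
  have hmem : ∀ x : H, (M x).map c ∈ ZeroSum (Set.range (target c m)) := by
    refine fun x => ⟨fun t ht => ?_, ?_⟩
    · obtain ⟨b, hb, rfl⟩ := Multiset.mem_map.1 ht
      exact mem_range_target_of_weight (hblocks x b hb)
    · rw [← map_multiset_sum, hsum]
      exact (hH x).2 x.2
  have heq : ∀ (x : H) (B : Multiset G), weight c m x = multRat B → (M x).map c = B :=
    fun x B h => multRat_injective ((hmult x).trans h)
  let θ : H →+ ZeroSum (Set.range (target c m)) :=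
    { toFun := fun x => ⟨(M x).map c, hmem x⟩
      map_zero' := Subtype.ext (heq 0 0 (by simp))
      map_add' := fun x y => Subtype.ext (heq (x + y) ((M x).map c + (M y).map c)
        (by simp [hmult])) }
  refine ⟨θ, ?_, fun a ha => ?_, fun u B C h => ?_⟩
  · rintro ⟨B, hB, hB0⟩
    obtain ⟨A, hmap⟩ : ∃ A : Multiset P, A.map (target c m) = B := by
      choose f hf using hB
      refine ⟨B.attach.map fun t => f t.1 t.2, ?_⟩
      rw [Multiset.map_map]
      exact (Multiset.map_congr rfl fun t _ => hf t.1 t.2).trans (Multiset.attach_map_val B)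
    set N := A.map fun p => Finsupp.single p (m p) with hN
    have hcs : ∀ p, c (Finsupp.single p (m p)) = target c m p := fun p => by
      rw [target, ← map_nsmul, Finsupp.smul_single, smul_eq_mul, mul_one]
    have hNc : N.map c = B := by
      rw [hN, Multiset.map_map]
      simpa [Function.comp_def, hcs] using hmap
    have hNb : IsBlocks c m N := by
      intro b hb
      obtain ⟨p, -, rfl⟩ := Multiset.mem_map.1 hb
      have hmp : (m p : ℚ) ≠ 0 := by
        exact_mod_cast (Nat.pos_of_dvd_of_pos (hm.1 p) (hG _)).ne'
      rw [weight_single, hcs, mul_inv_cancel₀ hmp]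
    refine ⟨⟨N.sum, (hH _).1 (by rw [map_multiset_sum, hNc, hB0])⟩, Subtype.ext (heq _ _ ?_)⟩
    rw [hNb.weight_sum, hNc]
  · have h0 : (M a).map c = 0 := congrArg Subtype.val ha
    rw [Multiset.map_eq_zero] at h0
    apply Subtype.ext
    rw [← hsum a, h0]
    simp
  · have hBC : (M u).map c = (B : Multiset G) + C := congrArg Subtype.val h
    obtain ⟨M₁, M₂, hM, h₁, h₂⟩ := exists_add_of_map_eq_add _ _ _ _ hBC
    have hb₁ : IsBlocks c m M₁ := fun b hb =>
      hblocks u b (by rw [hM]; exact Multiset.mem_add.2 (Or.inl hb))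
    have hb₂ : IsBlocks c m M₂ := fun b hb =>
      hblocks u b (by rw [hM]; exact Multiset.mem_add.2 (Or.inr hb))
    refine ⟨⟨M₁.sum, (hH _).1 (by rw [map_multiset_sum, h₁]; exact B.2.2)⟩,
      ⟨M₂.sum, (hH _).1 (by rw [map_multiset_sum, h₂]; exact C.2.2)⟩, Subtype.ext ?_,
      Subtype.ext (heq _ _ ?_), Subtype.ext (heq _ _ ?_)⟩
    · simp [← hsum u, hM]
    · rw [hb₁.weight_sum, h₁]
    · rw [hb₂.weight_sum, h₂]

end Weights

end TorsionTransfer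

/-- Let `H ⊆ F(P)` be a submonoid such that `H ↪ F(P)` is a divisor
theory whose class group `G = q(F)/q(H)` is a torsion group. Then there exists a subset
`G₀* ⊆ G` such that `B(G₀*) ↪ F(G₀*)` is a divisor theory and a transfer homomorphism
`θ* : H → B(G₀*)`. -/
theorem transfer_of_krull_torsion_class_group {P : Type*} (H : AddSubmonoid (P →₀ ℕ))
    (hdt : IsDivTheoryF H) (htor : IsTorsionAdd (ClassGrp H)) :
    ∃ G0s : Set (ClassGrp H),
      IsDivisorTheoryB G0s ∧
      ∃ θ : ↥H →+ ↥(ZeroSum G0s), IsTransferHomAdd θ := by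
  have hG : ∀ g : ClassGrp H, 0 < addOrderOf g := fun g => by
    obtain ⟨n, hn, hng⟩ := htor g
    exact addOrderOf_pos_iff.2 (isOfFinAddOrder_iff_nsmul_eq_zero.2 ⟨n, hn, hng⟩)
  obtain ⟨m, hm⟩ := TorsionTransfer.exists_maximal_admissible (TorsionTransfer.natCls H) hG
  exact ⟨_, TorsionTransfer.isDivisorTheoryB_of_maximal hG hm,
    TorsionTransfer.exists_transferHom hG hm.prop H (TorsionTransfer.natCls_eq_zero_iff hdt.1)⟩
end

section
/- Let P be a set, F = F(P) the free abelian monoid over P, and H ⊆ F a submonoid such that the inclusion H ↪ F is a cofinal divisor homomorphism, with class group G = q(F)/q(H) and G_P = {[p] : p ∈ P}. For h ∈ H let β(h) ∈ F(G_P) be the multiset containing [p] with multiplicity h(p) for each p ∈ P. Then β(h) ∈ B(G_P) for every h ∈ H, and β: H → B(G_P) is a transfer homomorphism. -/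
open scoped Classical

/-- The block map: `β(h)` is the multiset containing `[p]` with multiplicity `h(p)`. -/
noncomputable def blockify {P : Type*} (H : AddSubmonoid (P →₀ ℕ)) (x : P →₀ ℕ) :
    Multiset (ClassGrp H) :=
  x.sum fun p n => Multiset.replicate n (clsOf H (Finsupp.single p 1))

/-- A decomposition of the image of a multiset lifts to a decomposition of the multiset. -/
theorem Multiset.exists_add_of_map_eq_add {α β : Type*} (f : α → β) (b c : Multiset β)
    (s : Multiset α) (h : s.map f = b + c) :
    ∃ t u : Multiset α, s = t + u ∧ t.map f = b ∧ u.map f = c := by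
  induction b using Multiset.induction_on generalizing s with
  | empty => exact ⟨0, s, by simp, by simp, by simpa using h⟩
  | cons a b ih =>
    rw [Multiset.cons_add] at h
    have ha : a ∈ s.map f := h ▸ Multiset.mem_cons_self a (b + c)
    obtain ⟨x, hx, rfl⟩ := Multiset.mem_map.mp ha
    obtain ⟨s, rfl⟩ := Multiset.exists_cons_of_mem hx
    rw [Multiset.map_cons, Multiset.cons_inj_right] at h
    obtain ⟨t, u, rfl, rfl, rfl⟩ := ih s h
    exact ⟨x ::ₘ t, u, by simp, by simp, rfl⟩

section BlockHomomorphism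

variable {P : Type*} (H : AddSubmonoid (P →₀ ℕ))

theorem blockify_eq_map (x : P →₀ ℕ) :
    blockify H x =
      (Finsupp.toMultiset x).map fun p => clsOf H (Finsupp.single p 1) := by
  rw [Finsupp.toMultiset_apply, Finsupp.sum, ← Multiset.coe_mapAddMonoidHom, map_sum]
  simp [blockify, Finsupp.sum, Multiset.nsmul_singleton]

theorem blockify_add (x y : P →₀ ℕ) :
    blockify H (x + y) = blockify H x + blockify H y := by
  simp [blockify_eq_map]

theorem sum_blockify (x : P →₀ ℕ) : (blockify H x).sum = clsOf H (toIntF x) := by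
  induction x using Finsupp.induction_linear with
  | zero => simp [blockify_eq_map]
  | add x y hx hy => rw [blockify_add, Multiset.sum_add, hx, hy, map_add, map_add]
  | single p n =>
    rw [blockify, Finsupp.sum_single_index (by simp), Multiset.sum_replicate, ← map_nsmul]
    simp [toIntF]

theorem toIntF_injective : Function.Injective (toIntF : (P →₀ ℕ) →+ (P →₀ ℤ)) :=
  Finsupp.mapRange_injective _ Nat.cast_zero Nat.cast_injective

theorem mem_qHsub_iff (z : P →₀ ℤ) :
    z ∈ qHsub H ↔ ∃ a ∈ H, ∃ b ∈ H, z = toIntF a - toIntF b := by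
  constructor
  · intro hz
    induction hz using AddSubgroup.closure_induction with
    | mem z hz =>
      obtain ⟨a, ha, rfl⟩ := hz
      exact ⟨a, ha, 0, H.zero_mem, by simp⟩
    | zero => exact ⟨0, H.zero_mem, 0, H.zero_mem, by simp⟩
    | add x y _ _ hx hy =>
      obtain ⟨a, ha, b, hb, rfl⟩ := hx
      obtain ⟨c, hc, d, hd, rfl⟩ := hy
      exact ⟨a + c, H.add_mem ha hc, b + d, H.add_mem hb hd, by rw [map_add, map_add]; abel⟩
    | neg x _ hx =>
      obtain ⟨a, ha, b, hb, rfl⟩ := hx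
      exact ⟨b, hb, a, ha, by abel⟩
  · rintro ⟨a, ha, b, hb, rfl⟩
    exact sub_mem (AddSubgroup.subset_closure ⟨a, ha, rfl⟩)
      (AddSubgroup.subset_closure ⟨b, hb, rfl⟩)

theorem clsOf_eq_zero_iff (z : P →₀ ℤ) : clsOf H z = 0 ↔ z ∈ qHsub H :=
  QuotientAddGroup.eq_zero_iff z

variable {H}

/-- For a divisor homomorphism `H ↪ F(P)`, the elements of `F(P)` of trivial class are exactly
those of `H`. -/
theorem IsDivHomF.clsOf_toIntF_eq_zero_iff (hdiv : IsDivHomF H) (x : P →₀ ℕ) :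
    clsOf H (toIntF x) = 0 ↔ x ∈ H := by
  rw [clsOf_eq_zero_iff, mem_qHsub_iff]
  constructor
  · rintro ⟨a, ha, b, hb, h⟩
    have hab : x + b = a := toIntF_injective (by rw [map_add, h, sub_add_cancel])
    have := hdiv b hb a ha (hab ▸ le_add_self)
    rwa [← hab, add_tsub_cancel_right] at this
  · exact fun hx => ⟨x, hx, 0, H.zero_mem, by simp⟩

theorem IsDivHomF.blockify_mem_zeroSum_iff (hdiv : IsDivHomF H) (x : P →₀ ℕ) :
    blockify H x ∈ ZeroSum (GPset H) ↔ x ∈ H := by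
  rw [← hdiv.clsOf_toIntF_eq_zero_iff, ← sum_blockify]
  refine ⟨fun h => h.2, fun h => ⟨fun g hg => ?_, h⟩⟩
  rw [blockify_eq_map] at hg
  obtain ⟨p, -, rfl⟩ := Multiset.mem_map.mp hg
  exact ⟨p, rfl⟩

theorem exists_blockify_eq (S : Multiset (ClassGrp H)) (hS : ∀ g ∈ S, g ∈ GPset H) :
    ∃ x : P →₀ ℕ, blockify H x = S := by
  have : CanLift (ClassGrp H) P (fun p => clsOf H (Finsupp.single p 1)) (· ∈ GPset H) :=
    ⟨fun _ hg => hg.imp fun _ => Eq.symm⟩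
  lift S to Multiset P using hS
  exact ⟨Multiset.toFinsupp S, by rw [blockify_eq_map, Multiset.toFinsupp_toMultiset]⟩

theorem exists_add_of_blockify_eq_add (x : P →₀ ℕ) (b c : Multiset (ClassGrp H))
    (h : blockify H x = b + c) :
    ∃ v w : P →₀ ℕ, x = v + w ∧ blockify H v = b ∧ blockify H w = c := by
  rw [blockify_eq_map] at h
  obtain ⟨t, u, htu, rfl, rfl⟩ := Multiset.exists_add_of_map_eq_add _ b c _ h
  refine ⟨Multiset.toFinsupp t, Multiset.toFinsupp u, ?_, ?_, ?_⟩
  · rw [← map_add, ← htu, Finsupp.toMultiset_toFinsupp]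
  · rw [blockify_eq_map, Multiset.toFinsupp_toMultiset]
  · rw [blockify_eq_map, Multiset.toFinsupp_toMultiset]

theorem blockify_eq_zero_iff (x : P →₀ ℕ) : blockify H x = 0 ↔ x = 0 := by
  rw [blockify_eq_map, Multiset.map_eq_zero]
  exact map_eq_zero_iff Multiset.toFinsupp.symm Multiset.toFinsupp.symm.injective

end BlockHomomorphism

/-- If `H ↪ F(P)` is a cofinal divisor homomorphism with class group `G`
and `G_P = {[p] : p ∈ P}`, then `β(h) ∈ B(G_P)` for every `h ∈ H`, and the induced map
`β : H → B(G_P)` is a transfer homomorphism. -/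
theorem block_homomorphism_is_transfer {P : Type*} (H : AddSubmonoid (P →₀ ℕ))
    (hdiv : IsDivHomF H) (hcof : IsCofinalF H) :
    (∀ h ∈ H, blockify H h ∈ ZeroSum (GPset H)) ∧
    ∃ θ : ↥H →+ ↥(ZeroSum (GPset H)),
      (∀ h : ↥H, (θ h : Multiset (ClassGrp H)) = blockify H (h : P →₀ ℕ)) ∧
      IsTransferHomAdd θ := by
  have hmem := hdiv.blockify_mem_zeroSum_iff
  refine ⟨fun h => (hmem h).mpr,
    { toFun := fun h => ⟨blockify H h, (hmem h).mpr h.2⟩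
      map_zero' := Subtype.ext ((blockify_eq_zero_iff _).mpr rfl)
      map_add' := fun x y => Subtype.ext (blockify_add H x y) },
    fun _ => rfl, ?_, ?_, ?_⟩
  · rintro ⟨S, hS⟩
    obtain ⟨x, rfl⟩ := exists_blockify_eq S hS.1
    exact ⟨⟨x, (hmem x).mp hS⟩, rfl⟩
  · intro a ha
    exact Subtype.ext ((blockify_eq_zero_iff _).mp (congrArg Subtype.val ha))
  · rintro ⟨u, hu⟩ ⟨b, hb⟩ ⟨c, hc⟩ h
    obtain ⟨v, w, rfl, rfl, rfl⟩ :=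
      exists_add_of_blockify_eq_add u b c (congrArg Subtype.val h)
    exact ⟨⟨v, (hmem v).mp hb⟩, ⟨w, (hmem w).mp hc⟩, rfl, rfl, rfl⟩
end

section
/- Let P be a set, F = F(P) the free abelian monoid over P, and H ⊆ F a submonoid such that the inclusion H ↪ F is a cofinal divisor homomorphism, with class group G = q(F)/q(H) and G_P = {[p] : p ∈ P}. Then the inclusion B(G_P) ↪ F(G_P) is cofinal, i.e., for every S ∈ F(G_P) there exists B ∈ B(G_P) such that S is a submultiset of B. -/
open scoped Classical

/-- The sum of the classes of the prime divisors of `x`, with multiplicity, is the class of `x`. -/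
theorem sum_map_clsOf_toMultiset {P : Type*} (H : AddSubmonoid (P →₀ ℕ)) (x : P →₀ ℕ) :
    ((Finsupp.toMultiset x).map fun p => clsOf H (Finsupp.single p 1)).sum =
      clsOf H (toIntF x) := by
  induction x using Finsupp.induction_linear with
  | zero => simp
  | add x y hx hy => simp only [map_add, Multiset.map_add, Multiset.sum_add, hx, hy]
  | single p n =>
    have h : (toIntF (Finsupp.single p n) : P →₀ ℤ) = n • Finsupp.single p 1 := by
      simp [toIntF]
    rw [h, map_nsmul, Finsupp.toMultiset_single, Multiset.map_nsmul, Multiset.sum_nsmul,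
      Multiset.map_singleton, Multiset.sum_singleton]

/-- Elements of `H` have trivial class. -/
theorem clsOf_toIntF_eq_zero {P : Type*} {H : AddSubmonoid (P →₀ ℕ)} {h : P →₀ ℕ} (hh : h ∈ H) :
    clsOf H (toIntF h) = 0 :=
  (QuotientAddGroup.eq_zero_iff _).mpr (AddSubgroup.subset_closure ⟨h, hh, rfl⟩)

/-- If `H ↪ F(P)` is a cofinal divisor homomorphism with class group
`G = q(F)/q(H)` and `G_P = {[p] : p ∈ P}`, then the inclusion `B(G_P) ↪ F(G_P)` is
cofinal: every multiset with entries in `G_P` is a submultiset of a zero-sum one. -/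
theorem cofinal_of_block_monoid {P : Type*} (H : AddSubmonoid (P →₀ ℕ))
    (hdiv : IsDivHomF H) (hcof : IsCofinalF H) :
    ∀ S : Multiset (ClassGrp H), (∀ x ∈ S, x ∈ GPset H) →
      ∃ B ∈ ZeroSum (GPset H), S ≤ B := by
  intro S hS
  obtain ⟨T, rfl⟩ : ∃ T : Multiset P, T.map (fun p => clsOf H (Finsupp.single p 1)) = S := by
    induction S using Multiset.induction with
    | empty => exact ⟨0, rfl⟩
    | cons a S ih =>
      obtain ⟨T, rfl⟩ := ih fun x hx => hS x (Multiset.mem_cons_of_mem hx)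
      obtain ⟨p, rfl⟩ := hS a (Multiset.mem_cons_self a _)
      exact ⟨p ::ₘ T, Multiset.map_cons _ _ _⟩
  obtain ⟨h, hh, hle⟩ := hcof (Multiset.toFinsupp T)
  refine ⟨(Finsupp.toMultiset h).map fun p => clsOf H (Finsupp.single p 1), ⟨?_, ?_⟩, ?_⟩
  · intro x hx
    obtain ⟨p, -, rfl⟩ := Multiset.mem_map.mp hx
    exact ⟨p, rfl⟩
  · rw [sum_map_clsOf_toMultiset, clsOf_toIntF_eq_zero hh]
  · refine Multiset.map_le_map ?_
    rw [← Multiset.toFinsupp_toMultiset T]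
    exact Finsupp.toMultiset_strictMono.monotone hle
end

section
/- Let G be an additive abelian group and G_0 ⊆ G a subset. The inclusion B(G_0) ↪ F(G_0) is a divisor theory if and only if for every g ∈ G_0 the subgroup ⟨G_0⟩ of G generated by G_0 coincides with the submonoid [G_0 ∖ {g}] of G generated by G_0 ∖ {g}. -/
open scoped Classical

theorem AddSubmonoid.sum_mem_closure_diff_singleton {G : Type*} [AddCommGroup G] {G0 : Set G}
    {g : G} {S : Multiset G} (hS : ∀ x ∈ S, x ∈ G0) (hg : g ∉ S) :
    S.sum ∈ AddSubmonoid.closure (G0 \ {g}) :=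
  AddSubmonoid.multiset_sum_mem _ _ fun x hx =>
    AddSubmonoid.subset_closure ⟨hS x hx, fun h => hg (h ▸ hx)⟩

theorem AddSubmonoid.neg_mem_of_mem_of_mem_zeroSum {G : Type*} [AddCommGroup G] {G0 : Set G}
    {g h : G} {B : Multiset G} (hB : B ∈ ZeroSum G0) (hh : h ∈ B) (hg : g ∉ B.erase h) :
    -h ∈ AddSubmonoid.closure (G0 \ {g}) := by
  have hsum : h + (B.erase h).sum = 0 := by
    rw [← Multiset.sum_cons, Multiset.cons_erase hh]
    exact hB.2
  rw [neg_eq_of_add_eq_zero_right hsum]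
  exact AddSubmonoid.sum_mem_closure_diff_singleton
    (fun x hx => hB.1 x (Multiset.mem_of_mem_erase hx)) hg

theorem IsDivisorTheoryB.neg_mem_closure {G : Type*} [AddCommGroup G] {G0 : Set G}
    (H : IsDivisorTheoryB G0) (g : G) {h : G} (hh : h ∈ G0) :
    -h ∈ AddSubmonoid.closure (G0 \ {g}) := by
  obtain ⟨X, hX, hsub, hgcd⟩ := H h hh
  obtain ⟨B, hB, hmin⟩ := X.exists_mem_eq_inf' hX (fun B => Multiset.count g B)
  have hcount : Multiset.count g B = Multiset.count g {h} := by rw [← hmin, hgcd g]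
  have hpos : 1 ≤ Multiset.count h B := by
    have := X.inf'_le (fun B => Multiset.count h B) hB
    rwa [hgcd h, Multiset.count_singleton_self] at this
  refine AddSubmonoid.neg_mem_of_mem_of_mem_zeroSum (hsub hB)
    (Multiset.one_le_count_iff_mem.mp hpos) ?_
  rw [← Multiset.count_eq_zero]
  by_cases hgh : g = h
  · subst hgh
    rw [Multiset.count_erase_self, hcount, Multiset.count_singleton_self]
  · rw [Multiset.count_erase_of_ne hgh, hcount, Multiset.count_singleton, if_neg hgh]

theorem IsDivisorTheoryB.closure_eq {G : Type*} [AddCommGroup G] {G0 : Set G}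
    (H : IsDivisorTheoryB G0) (g : G) :
    (AddSubgroup.closure G0 : Set G) = (AddSubmonoid.closure (G0 \ {g}) : Set G) := by
  have hneg : ∀ x ∈ AddSubmonoid.closure (G0 \ {g}),
      -x ∈ AddSubmonoid.closure (G0 \ {g}) := by
    intro x hx
    induction hx using AddSubmonoid.closure_induction with
    | mem x hx => exact H.neg_mem_closure g hx.1
    | zero => simp
    | add x y _ _ hx hy =>
      rw [neg_add]
      exact add_mem hx hy
  have hmem : ∀ x ∈ G0, x ∈ AddSubmonoid.closure (G0 \ {g}) := fun x hx => by
    simpa using hneg _ (H.neg_mem_closure g hx)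
  refine Set.Subset.antisymm (fun x hx => ?_) (fun x hx => ?_)
  · induction hx using AddSubgroup.closure_induction with
    | mem x hx => exact hmem x hx
    | zero => exact zero_mem _
    | add x y _ _ hx hy => exact add_mem hx hy
    | neg x _ hx => exact hneg x hx
  · exact AddSubgroup.le_closure_toAddSubmonoid G0
      (AddSubmonoid.closure_mono Set.sdiff_subset hx)

theorem isDivisorTheoryB_of_neg_mem_closure {G : Type*} [AddCommGroup G] {G0 : Set G}
    (H : ∀ g ∈ G0, ∀ h ∈ G0, -g ∈ AddSubmonoid.closure (G0 \ {h})) :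
    IsDivisorTheoryB G0 := by
  intro g hg
  have hex : ∀ h, ∃ T : Multiset G, h ∈ G0 →
      (∀ x ∈ T, x ∈ G0 \ {h}) ∧ T.sum = -g := fun h => by
    by_cases hh : h ∈ G0
    · obtain ⟨T, hT⟩ := AddSubmonoid.exists_multiset_of_mem_closure (H g hg h hh)
      exact ⟨T, fun _ => hT⟩
    · exact ⟨0, fun h' => absurd h' hh⟩
  choose T hT using hex
  have hnot : ∀ h ∈ G0, Multiset.count h (T h) = 0 := fun h hh =>
    Multiset.count_eq_zero.mpr fun hm => ((hT h hh).1 h hm).2 rfl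
  have hI : ∀ h ∈ insert g (T g).toFinset, h ∈ G0 := by
    intro h hh
    rcases Finset.mem_insert.mp hh with rfl | hh
    · exact hg
    · exact ((hT g hg).1 h (Multiset.mem_toFinset.mp hh)).1
  refine ⟨(insert g (T g).toFinset).image fun h => g ::ₘ T h,
    (Finset.insert_nonempty _ _).image _, ?_, fun h => ?_⟩
  · intro B hB
    obtain ⟨h, hh, rfl⟩ := Finset.mem_image.mp (Finset.mem_coe.mp hB)
    refine ⟨fun x hx => ?_, ?_⟩
    · rcases Multiset.mem_cons.mp hx with rfl | hx
      · exact hg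
      · exact ((hT h (hI h hh)).1 x hx).1
    · rw [Multiset.sum_cons, (hT h (hI h hh)).2, add_neg_cancel]
  · refine le_antisymm ?_ (Finset.le_inf' _ _ fun B hB => ?_)
    · obtain ⟨k, hk, hkh⟩ : ∃ k ∈ insert g (T g).toFinset, Multiset.count h (T k) = 0 := by
        by_cases hh : h ∈ insert g (T g).toFinset
        · exact ⟨h, hh, hnot h (hI h hh)⟩
        · refine ⟨g, Finset.mem_insert_self _ _, Multiset.count_eq_zero.mpr fun hm => hh ?_⟩
          exact Finset.mem_insert_of_mem (Multiset.mem_toFinset.mpr hm)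
      refine (Finset.inf'_le _ (Finset.mem_image_of_mem _ hk)).trans_eq ?_
      rw [← Multiset.singleton_add, Multiset.count_add, hkh, add_zero]
    · obtain ⟨k, -, rfl⟩ := Finset.mem_image.mp hB
      rw [← Multiset.singleton_add, Multiset.count_add]
      exact Nat.le_add_right _ _

/-- The inclusion `B(G0) ↪ F(G0)` is a divisor theory if and only if,
for every `g ∈ G0`, the subgroup `⟨G0⟩` generated by `G0` coincides with the submonoid
`[G0 ∖ {g}]` generated by `G0 ∖ {g}`. -/
theorem divisor_theory_iff_generation {G : Type*} [AddCommGroup G] (G0 : Set G) :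
    IsDivisorTheoryB G0 ↔
      ∀ g ∈ G0, (AddSubgroup.closure G0 : Set G) =
        (AddSubmonoid.closure (G0 \ {g}) : Set G) := by
  refine ⟨fun H g _ => H.closure_eq g, fun H => ?_⟩
  refine isDivisorTheoryB_of_neg_mem_closure fun g hg h hh => ?_
  rw [← SetLike.mem_coe, ← H h hh]
  exact neg_mem (AddSubgroup.subset_closure hg)
end

section
/- Let G be an additive abelian group and G_0 ⊆ G a condensed subset. Let σ̂ denote the group homomorphism from the free abelian group on G_0 (finitely supported functions G_0 → ℤ) to G induced by g ↦ g. Then the kernel of σ̂ equals the subgroup generated by (the images of) the elements of B(G_0), and [G_0] = ⟨G_0⟩; consequently σ̂ induces a group isomorphism from the quotient of the free abelian group on G_0 by the subgroup generated by B(G_0) onto [G_0]. -/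
open scoped Classical

/-- The homomorphism `σ̂` from the free abelian group on `G0` to `G` induced by
`g ↦ g`. -/
noncomputable def sigmaHat {G : Type*} [AddCommGroup G] (G0 : Set G) : (↥G0 →₀ ℤ) →+ G :=
  Finsupp.liftAddHom fun g =>
    AddMonoidHom.mk' (fun n : ℤ => n • (g : G)) (fun a b => add_zsmul (g : G) a b)

/-- The inclusion of the free abelian monoid on `G0` into the free abelian group on `G0`. -/
noncomputable def multiplicityVector {G : Type*} (G0 : Set G) : Multiset ↥G0 →+ (↥G0 →₀ ℤ) :=
  (Finsupp.mapRange.addMonoidHom (Nat.castAddMonoidHom ℤ)).comp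
    Multiset.toFinsupp.toAddMonoidHom

theorem multiplicityVector_apply {G : Type*} (G0 : Set G) (S : Multiset ↥G0) (g : ↥G0) :
    multiplicityVector G0 S g = (Multiset.count g S : ℤ) := by
  simp [multiplicityVector]

theorem multiplicityVector_singleton {G : Type*} (G0 : Set G) (g : ↥G0) :
    multiplicityVector G0 {g} = Finsupp.single g 1 := by
  simp [multiplicityVector]

theorem sigmaHat_single {G : Type*} [AddCommGroup G] (G0 : Set G) (g : ↥G0) (n : ℤ) :
    sigmaHat G0 (Finsupp.single g n) = n • (g : G) := by
  simp [sigmaHat]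

theorem sigmaHat_multiplicityVector {G : Type*} [AddCommGroup G] (G0 : Set G)
    (S : Multiset ↥G0) :
    sigmaHat G0 (multiplicityVector G0 S) = (S.map Subtype.val).sum := by
  induction S using Multiset.induction with
  | empty => simp
  | cons g S ih =>
    rw [← Multiset.singleton_add, map_add, map_add, ih, multiplicityVector_singleton,
      sigmaHat_single]
    simp

/-- The vectors of multiplicities of zero-sum sequences over `G0`. -/
theorem zeroSum_vectors_eq {G : Type*} [AddCommGroup G] (G0 : Set G) :
    {y : ↥G0 →₀ ℤ | ∃ S ∈ ZeroSum G0, ∀ g : ↥G0, y g = (Multiset.count (g : G) S : ℤ)} =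
      multiplicityVector G0 '' {S | (S.map Subtype.val).sum = 0} := by
  ext y
  constructor
  · rintro ⟨S, ⟨hS, hsum⟩, hy⟩
    lift S to Multiset ↥G0 using hS
    refine ⟨S, hsum, Finsupp.ext fun g => ?_⟩
    rw [multiplicityVector_apply, hy, Multiset.count_map_eq_count' _ _ Subtype.val_injective]
  · rintro ⟨S, hsum, rfl⟩
    refine ⟨S.map Subtype.val, ⟨fun x hx => ?_, hsum⟩, fun g => ?_⟩
    · obtain ⟨g, -, rfl⟩ := Multiset.mem_map.mp hx
      exact g.2
    · rw [multiplicityVector_apply, Multiset.count_map_eq_count' _ _ Subtype.val_injective]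

theorem exists_cons_sum_eq_zero {G : Type*} [AddCommGroup G] {G0 : Set G}
    (hcond : ∀ g ∈ G0, ∃ B ∈ ZeroSum G0, 0 < Multiset.count g B) (g : ↥G0) :
    ∃ T : Multiset ↥G0, ((g ::ₘ T).map Subtype.val).sum = 0 := by
  obtain ⟨B, ⟨hB, hsum⟩, hg⟩ := hcond g g.2
  lift B to Multiset ↥G0 using hB
  rw [Multiset.count_map_eq_count' _ _ Subtype.val_injective, Multiset.count_pos] at hg
  obtain ⟨T, rfl⟩ := Multiset.exists_cons_of_mem hg
  exact ⟨T, hsum⟩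

/-- Over a condensed set, every element of the free abelian group is congruent to an element
of the free abelian monoid modulo the subgroup generated by zero-sum sequences. -/
theorem exists_add_eq_multiplicityVector {G : Type*} [AddCommGroup G] {G0 : Set G}
    (hcond : ∀ g ∈ G0, ∃ B ∈ ZeroSum G0, 0 < Multiset.count g B) (y : ↥G0 →₀ ℤ) :
    ∃ b ∈ AddSubgroup.closure (multiplicityVector G0 '' {S | (S.map Subtype.val).sum = 0}),
      ∃ S, y + b = multiplicityVector G0 S := by
  induction y using Finsupp.induction_linear with
  | zero => exact ⟨0, zero_mem _, 0, by simp⟩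
  | add y z hy hz =>
    obtain ⟨b, hb, S, hS⟩ := hy
    obtain ⟨c, hc, T, hT⟩ := hz
    exact ⟨b + c, add_mem hb hc, S + T, by rw [map_add, ← hS, ← hT, add_add_add_comm]⟩
  | single g n =>
    obtain ⟨m, rfl | rfl⟩ := n.eq_nat_or_neg
    · refine ⟨0, zero_mem _, m • {g}, ?_⟩
      rw [map_nsmul, multiplicityVector_singleton]
      simp
    · obtain ⟨T, hT⟩ := exists_cons_sum_eq_zero hcond g
      have hmem : multiplicityVector G0 (g ::ₘ T) ∈
          AddSubgroup.closure (multiplicityVector G0 '' {S | (S.map Subtype.val).sum = 0}) :=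
        AddSubgroup.subset_closure ⟨g ::ₘ T, hT, rfl⟩
      refine ⟨m • multiplicityVector G0 (g ::ₘ T), AddSubgroup.nsmul_mem _ hmem m, m • T, ?_⟩
      rw [← Multiset.singleton_add, map_add, map_nsmul, multiplicityVector_singleton, smul_add,
        ← add_assoc]
      simp

theorem sigmaHat_ker {G : Type*} [AddCommGroup G] {G0 : Set G}
    (hcond : ∀ g ∈ G0, ∃ B ∈ ZeroSum G0, 0 < Multiset.count g B) :
    (sigmaHat G0).ker =
      AddSubgroup.closure (multiplicityVector G0 '' {S | (S.map Subtype.val).sum = 0}) := by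
  have hle : AddSubgroup.closure (multiplicityVector G0 '' {S | (S.map Subtype.val).sum = 0}) ≤
      (sigmaHat G0).ker := by
    rw [AddSubgroup.closure_le]
    rintro _ ⟨S, hS, rfl⟩
    exact (sigmaHat_multiplicityVector G0 S).trans hS
  refine le_antisymm (fun y hy => ?_) hle
  obtain ⟨b, hb, S, hS⟩ := exists_add_eq_multiplicityVector hcond y
  have hsum : (S.map Subtype.val).sum = 0 := by
    rw [← sigmaHat_multiplicityVector, ← hS]
    exact add_mem hy (hle hb)
  rw [eq_sub_of_add_eq hS]
  exact sub_mem (AddSubgroup.subset_closure ⟨S, hsum, rfl⟩) hb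

theorem sigmaHat_range {G : Type*} [AddCommGroup G] (G0 : Set G) :
    (sigmaHat G0).range = AddSubgroup.closure G0 := by
  apply le_antisymm
  · rintro _ ⟨y, rfl⟩
    induction y using Finsupp.induction_linear with
    | zero => simp
    | add y z hy hz => rw [map_add]; exact add_mem hy hz
    | single g n =>
      rw [sigmaHat_single]
      exact zsmul_mem (AddSubgroup.subset_closure g.2) n
  · rw [AddSubgroup.closure_le]
    exact fun g hg => ⟨Finsupp.single ⟨g, hg⟩ 1, by simp [sigmaHat_single]⟩

theorem addSubmonoid_closure_eq_addSubgroup_closure {G : Type*} [AddCommGroup G] {G0 : Set G}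
    (hcond : ∀ g ∈ G0, ∃ B ∈ ZeroSum G0, 0 < Multiset.count g B) :
    (AddSubmonoid.closure G0 : Set G) = (AddSubgroup.closure G0 : Set G) := by
  have hneg : ∀ g ∈ G0, -g ∈ AddSubmonoid.closure G0 := by
    intro g hg
    obtain ⟨T, hT⟩ := exists_cons_sum_eq_zero hcond ⟨g, hg⟩
    rw [Multiset.map_cons, Multiset.sum_cons] at hT
    rw [neg_eq_of_add_eq_zero_right hT]
    refine AddSubmonoid.multiset_sum_mem _ _ fun x hx => ?_
    obtain ⟨h, -, rfl⟩ := Multiset.mem_map.mp hx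
    exact AddSubmonoid.subset_closure h.2
  rw [← AddSubgroup.coe_toAddSubmonoid, AddSubgroup.closure_toAddSubmonoid]
  congr 1
  refine le_antisymm (AddSubmonoid.closure_mono Set.subset_union_left) ?_
  rw [AddSubmonoid.closure_le]
  rintro x (hx | hx)
  · exact AddSubmonoid.subset_closure hx
  · simpa using hneg _ hx

/-- For a condensed subset `G0 ⊆ G`, the kernel of `σ̂` equals the
subgroup generated by the images of the zero-sum sequences over `G0`, `[G0] = ⟨G0⟩`, and
`σ̂` induces an isomorphism from the quotient of the free abelian group on `G0` by the
subgroup generated by `B(G0)` onto `[G0]`. -/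
theorem sigmaHat_ker_and_iso {G : Type*} [AddCommGroup G] (G0 : Set G)
    (hcond : ∀ g ∈ G0, ∃ B ∈ ZeroSum G0, 0 < Multiset.count g B) :
    (sigmaHat G0).ker =
      AddSubgroup.closure
        {y : ↥G0 →₀ ℤ | ∃ S ∈ ZeroSum G0, ∀ g : ↥G0, y g = (Multiset.count (g : G) S : ℤ)} ∧
    (AddSubmonoid.closure G0 : Set G) = (AddSubgroup.closure G0 : Set G) ∧
    ∃ φ : ((↥G0 →₀ ℤ) ⧸
        AddSubgroup.closure
          {y : ↥G0 →₀ ℤ | ∃ S ∈ ZeroSum G0,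
            ∀ g : ↥G0, y g = (Multiset.count (g : G) S : ℤ)}) ≃+
        ↥(AddSubgroup.closure G0),
      ∀ y : ↥G0 →₀ ℤ,
        (φ (QuotientAddGroup.mk y) : G) = sigmaHat G0 y := by
  rw [zeroSum_vectors_eq]
  refine ⟨sigmaHat_ker hcond, addSubmonoid_closure_eq_addSubgroup_closure hcond,
    ((QuotientAddGroup.quotientAddEquivOfEq (sigmaHat_ker hcond).symm).trans
      (QuotientAddGroup.quotientKerEquivRange (sigmaHat G0))).trans
      (AddEquiv.addSubgroupCongr (sigmaHat_range G0)), fun y => rfl⟩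
end

section
/- Let s ≥ 2 be an integer and let k_2, …, k_s ∈ ℚ with k_ν ≠ −1 for all ν ∈ {2, …, s}. Let G_1 ⊆ {a = (a_1, …, a_s) ∈ ℤ^s : a_ν = k_ν·a_1 in ℚ for all ν ∈ {2, …, s}} and G_2 ⊆ {b = (b_1, …, b_s) ∈ ℤ^s ∖ {0} : b_2 = −b_1}, and set G_0 = G_1 ∪ G_2. Then G_1 ∩ G_2 = ∅, and for every S ∈ B(G_0), writing S = S_1 + S_2 where S_1 ∈ F(G_1) is the submultiset of elements of S lying in G_1 and S_2 ∈ F(G_2) is the submultiset of elements lying in G_2, one has S_1 ∈ B(G_1) and S_2 ∈ B(G_2); thus B(G_0) is the inner direct product of B(G_1) and B(G_2). -/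
open scoped Classical

/-- The integer vectors `a` with `a i = k i * a j` for all `i ≠ j`. -/
def proportionalSubgroup {ι : Type*} (j : ι) (k : ι → ℚ) : AddSubgroup (ι → ℤ) where
  carrier := {a | ∀ i, i ≠ j → (a i : ℚ) = k i * (a j : ℚ)}
  zero_mem' := fun i _ => by simp
  add_mem' := fun ha hb i hi => by
    simp only [Pi.add_apply, Int.cast_add, ha i hi, hb i hi, mul_add]
  neg_mem' := fun ha i hi => by
    simp only [Pi.neg_apply, Int.cast_neg, ha i hi, mul_neg]

/-- The integer vectors `b` with `b i = -b j`. -/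
def oppositeSubgroup {ι : Type*} (i j : ι) : AddSubgroup (ι → ℤ) where
  carrier := {b | b i = -b j}
  zero_mem' := by simp
  add_mem' := fun {a b} (ha : a i = -a j) (hb : b i = -b j) => by
    simp only [Set.mem_ofPred_eq, Pi.add_apply, ha, hb, neg_add]
  neg_mem' := fun {a} (ha : a i = -a j) => by
    simp only [Set.mem_ofPred_eq, Pi.neg_apply, ha]

theorem disjoint_proportionalSubgroup_oppositeSubgroup {ι : Type*} {i j : ι} (hij : i ≠ j)
    {k : ι → ℚ} (hk : k i ≠ -1) :
    Disjoint (proportionalSubgroup j k) (oppositeSubgroup i j) := by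
  refine AddSubgroup.disjoint_def.mpr fun {a} ha hb => ?_
  replace ha : ∀ l, l ≠ j → (a l : ℚ) = k l * (a j : ℚ) := ha
  replace hb : a i = -a j := hb
  have hai := ha i hij
  rw [hb, Int.cast_neg] at hai
  have hmul : (k i + 1) * (a j : ℚ) = 0 := by linear_combination -hai
  have haj : (a j : ℚ) = 0 :=
    (mul_eq_zero.mp hmul).resolve_left fun h => hk (eq_neg_of_add_eq_zero_left h)
  funext l
  by_cases hl : l = j
  · exact hl ▸ Int.cast_eq_zero.mp haj
  · exact Int.cast_eq_zero.mp (by rw [ha l hl, haj, mul_zero])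

theorem filter_mem_zeroSum_of_disjoint {G : Type*} [AddCommGroup G] {H1 H2 : AddSubgroup G}
    (hH : Disjoint H1 H2) {G1 G2 : Set G} (h1 : G1 ⊆ H1) (h2 : G2 ⊆ H2)
    (hG : Disjoint G1 G2) {S : Multiset G} (hS : S ∈ ZeroSum (G1 ∪ G2)) :
    Multiset.filter (fun x => x ∈ G1) S ∈ ZeroSum G1 ∧
    Multiset.filter (fun x => x ∈ G2) S ∈ ZeroSum G2 ∧
    Multiset.filter (fun x => x ∈ G1) S + Multiset.filter (fun x => x ∈ G2) S = S := by
  obtain ⟨hmem, hsum⟩ := hS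
  have hadd : Multiset.filter (fun x => x ∈ G1) S + Multiset.filter (fun x => x ∈ G2) S = S := by
    have hcongr : Multiset.filter (fun x => x ∈ G2) S = Multiset.filter (fun x => x ∉ G1) S :=
      Multiset.filter_congr fun x hx =>
        ⟨fun hx2 hx1 => Set.disjoint_left.mp hG hx1 hx2, (hmem x hx).resolve_left⟩
    rw [hcongr]
    exact Multiset.filter_add_not _ S
  have hm1 : (Multiset.filter (fun x => x ∈ G1) S).sum ∈ H1 :=
    multiset_sum_mem _ fun x hx => h1 (Multiset.mem_filter.mp hx).2
  have hm2 : (Multiset.filter (fun x => x ∈ G2) S).sum ∈ H2 :=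
    multiset_sum_mem _ fun x hx => h2 (Multiset.mem_filter.mp hx).2
  have hzero : (Multiset.filter (fun x => x ∈ G1) S).sum
      + (Multiset.filter (fun x => x ∈ G2) S).sum = 0 := by
    rw [← Multiset.sum_add, hadd, hsum]
  have hz1 : (Multiset.filter (fun x => x ∈ G1) S).sum = 0 :=
    AddSubgroup.disjoint_def.mp hH hm1 (eq_neg_of_add_eq_zero_left hzero ▸ H2.neg_mem hm2)
  have hz2 : (Multiset.filter (fun x => x ∈ G2) S).sum = 0 := by
    rwa [hz1, zero_add] at hzero
  exact ⟨⟨fun x hx => (Multiset.mem_filter.mp hx).2, hz1⟩,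
    ⟨fun x hx => (Multiset.mem_filter.mp hx).2, hz2⟩, hadd⟩

/-- Let `s ≥ 2`, `k₂, …, k_s ∈ ℚ ∖ {-1}`,
`G₁ ⊆ {a ∈ ℤ^s : a_ν = k_ν a₁ for ν ∈ [2, s]}` and
`G₂ ⊆ {b ∈ ℤ^s ∖ {0} : b₂ = -b₁}`. Then `G₁ ∩ G₂ = ∅` and every zero-sum sequence over
`G₀ = G₁ ∪ G₂` splits as a sum of a zero-sum sequence over `G₁` and one over `G₂`;
thus `B(G₀)` is the inner direct product of `B(G₁)` and `B(G₂)`. -/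
theorem inner_direct_product (s : ℕ) (hs : 2 ≤ s) (k : Fin s → ℚ)
    (hk : ∀ i : Fin s, i ≠ ⟨0, by omega⟩ → k i ≠ -1)
    (G1 G2 : Set (Fin s → ℤ))
    (hG1 : G1 ⊆ {a : Fin s → ℤ | ∀ i : Fin s, i ≠ ⟨0, by omega⟩ →
      (a i : ℚ) = k i * (a ⟨0, by omega⟩ : ℚ)})
    (hG2 : G2 ⊆ {b : Fin s → ℤ | b ≠ 0 ∧ b ⟨1, by omega⟩ = - b ⟨0, by omega⟩}) :
    G1 ∩ G2 = ∅ ∧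
    ∀ S ∈ ZeroSum (G1 ∪ G2),
      Multiset.filter (fun x => x ∈ G1) S ∈ ZeroSum G1 ∧
      Multiset.filter (fun x => x ∈ G2) S ∈ ZeroSum G2 ∧
      Multiset.filter (fun x => x ∈ G1) S + Multiset.filter (fun x => x ∈ G2) S = S := by
  have hne : (⟨1, by omega⟩ : Fin s) ≠ ⟨0, by omega⟩ := by simp
  have hH := disjoint_proportionalSubgroup_oppositeSubgroup hne (hk _ hne)
  have hG : Disjoint G1 G2 := Set.disjoint_left.mpr fun x hx1 hx2 =>
    (hG2 hx2).1 (AddSubgroup.disjoint_def.mp hH (hG1 hx1) (hG2 hx2).2)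
  exact ⟨hG.inter_eq, fun S hS =>
    filter_mem_zeroSum_of_disjoint hH hG1 (fun x hx => (hG2 hx).2) hG hS⟩
end
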